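/- Let m ≥ 3, let γ be the growth function of the Mealy automaton B_m, and let γ^(m−2) denote its (m−2)-th finite difference. Then γ^(m−2) consists of doubled values: for every even integer n ≥ 0, γ^(m−2)(n+m) = γ^(m−2)(n+m−1). -/

import Mathlib

/-- The sequence of states visited by a Mealy automaton with transition function `tr`,
started at state `q`, while reading the infinite word `u`. -/
def stateSeq {X Q : Type*} (tr : X → Q → Q) (q : Q) (u : ℕ → X) : ℕ → Q
  | 0 => q
  | k + 1 => tr (u k) (stateSeq tr q u k)

/-- The automatic transformation of infinite words defined by the Mealy automaton with
transition function `tr` and output function `out` at the state `q`. -/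
def autTrans {X Q : Type*} (tr : X → Q → Q) (out : X → Q → X) (q : Q) (u : ℕ → X) : ℕ → X :=
  fun n => out (u n) (stateSeq tr q u n)

/-- The transformation given by a word of states: the product (composition, applied from
right to left) of the corresponding automatic transformations. -/
def wordTrans {X Q : Type*} (tr : X → Q → Q) (out : X → Q → X) (w : List Q) :
    (ℕ → X) → (ℕ → X) :=
  (w.map (autTrans tr out)).foldr (· ∘ ·) id

/-- The growth function of a Mealy automaton: `growth tr out n` is the number of distinct
transformations of infinite words obtained as compositions of exactly `n` automatic
transformations of the automaton. -/
noncomputable def growth {X Q : Type*} (tr : X → Q → Q) (out : X → Q → X) (n : ℕ) : ℕ :=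
  Set.ncard { g : (ℕ → X) → (ℕ → X) | ∃ w : List Q, w.length = n ∧ wordTrans tr out w = g }

/-- The `i`-th finite difference of a function `γ`. -/
def fdiff (γ : ℕ → ℤ) : ℕ → ℕ → ℤ
  | 0, n => γ n
  | i + 1, n => fdiff γ i n - fdiff γ i (n - 1)

/-- Output function of the automaton `B_m`: at `q0` the output swaps `x0` and `x1` and fixes
every other letter; at `q1` the output sends `x_i` to `x_{i+1}` for `i ≤ m−2` and fixes
`x_{m−1}`. -/
def bmOut (m : ℕ) : Fin m → Fin 2 → Fin m := fun x q =>
  if q = 0 then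
    if (x : ℕ) = 0 then ⟨1 % m, Nat.mod_lt 1 x.pos⟩
    else if (x : ℕ) = 1 then ⟨0, x.pos⟩
    else x
  else ⟨min (x.val + 1) (m - 1), by have := x.pos; omega⟩

/-- Transition function of the automaton `B_m`: from `q0` the transition goes to `q1` on
reading `x2` and stays at `q0` otherwise; from `q1` it goes to `q0` on reading `x0` and
stays at `q1` otherwise. -/
def bmTr (m : ℕ) : Fin m → Fin 2 → Fin 2 := fun x q =>
  if q = 0 then (if (x : ℕ) = 2 then 1 else 0)
  else (if (x : ℕ) = 0 then 0 else 1)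

/-- The automatic transformations `f0, f1` of the automaton `B_m` at states `q0, q1`. -/
def bmF (m : ℕ) (q : Fin 2) : (ℕ → Fin m) → (ℕ → Fin m) := autTrans (bmTr m) (bmOut m) q

namespace BM

/-- Letter produced by the word `w` (acting from the right) on the letter `x`. -/
def lt (m : ℕ) : List (Fin 2) → ℕ → ℕ
  | [], x => x
  | q :: w, x =>
    if q = 0 then (if lt m w x = 0 then 1 else if lt m w x = 1 then 0 else lt m w x)
    else min (lt m w x + 1) (m - 1)

/-- Section of the word `w` at the letter `x`. -/
def sc (m : ℕ) : List (Fin 2) → ℕ → List (Fin 2)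
  | [], _ => []
  | q :: w, x =>
    (if q = 0 then (if lt m w x = 2 then 1 else 0) else (if lt m w x = 0 then 0 else 1)) :: sc m w x

/-- The smallest position (counted from the right) of parity `p` holding the state `q1`. -/
def A (p : ℕ) : List (Fin 2) → Option ℕ
  | [] => none
  | b :: w =>
    if A p w = none then (if b = 1 ∧ w.length % 2 = p then some w.length else none) else A p w

theorem two (b : Fin 2) : b = 0 ∨ b = 1 := by omega

theorem sc_length (m : ℕ) (w : List (Fin 2)) (x : ℕ) : (sc m w x).length = w.length := by
  induction w with
  | nil => rfl
  | cons b w ih => simp [sc, ih]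

theorem A_zeros (p n : ℕ) : A p (List.replicate n 0) = none := by
  induction n with
  | zero => rfl
  | succ n ih => simp [List.replicate_succ, A, ih]

theorem lt_lt (m : ℕ) (hm : 3 ≤ m) (w : List (Fin 2)) (x : ℕ) (hx : x < m) : lt m w x < m := by
  induction w with
  | nil => exact hx
  | cons b w ih => rw [lt]; split_ifs <;> omega

theorem A_some (p t : ℕ) (w : List (Fin 2)) (h : A p w = some t) :
    t < w.length ∧ t % 2 = p := by
  induction w with
  | nil => simp [A] at h
  | cons b w ih =>
    simp only [A] at h
    split_ifs at h with h1 h2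
    · simp at h; subst h; simp [h2.2]
    · have := ih h; simp; omega

theorem main_none (m : ℕ) (hm : 3 ≤ m) (x p : ℕ) (hx : x + p = 1) (w : List (Fin 2))
    (h : A p w = none) :
    sc m w x = List.replicate w.length 0 ∧ lt m w x = (x + w.length) % 2 := by
  induction w with
  | nil => simp [sc, lt]; omega
  | cons b w ih =>
    simp only [A] at h
    split_ifs at h with h1 h2
    swap
    · exact absurd h h1
    obtain ⟨i1, i2⟩ := ih h1
    rcases two b with rfl | rfl
    · simp only [sc, lt, i1, i2, List.length_cons, List.replicate_succ]
      constructor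
      · simp; omega
      · split_ifs <;> omega
    · simp only [true_and] at h2
      have h3 : (x + w.length) % 2 = 0 := by omega
      simp only [sc, lt, i1, i2, List.length_cons, List.replicate_succ, h3]
      constructor
      · simp
      · simp; omega

theorem main_some (m : ℕ) (hm : 3 ≤ m) (x p : ℕ) (hx : x + p = 1) (w : List (Fin 2)) (t : ℕ)
    (h : A p w = some t) :
    2 ≤ lt m w x ∧ A p (sc m w x) = some t ∧
      A x (sc m w x) = (if t + 1 < w.length then some (t + 1) else none) ∧
      (t + 1 = w.length → lt m w x = 2) ∧
      (lt m w x = 2 → 4 ≤ m →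
        sc m w x = List.replicate (w.length - t) 1 ++ List.replicate t 0) := by
  induction w with
  | nil => simp [A] at h
  | cons b w ih =>
    have hs := A_some _ _ _ h
    simp only [A] at h
    split_ifs at h with h1 h2
    · simp only [Option.some.injEq] at h
      subst h
      obtain ⟨i1, i2⟩ := main_none m hm x p hx w h1
      obtain ⟨rfl, h3⟩ := h2
      have h4 : (x + w.length) % 2 = 1 := by omega
      rw [h4] at i2
      have e : sc m (1 :: w) x = 1 :: List.replicate w.length 0 := by simp [sc, i1, i2]
      have e2 : lt m (1 :: w) x = 2 := by simp [lt, i2]; omega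
      rw [e, e2]
      have : ¬ (p = x) := by omega
      simp [A, A_zeros, h3, this]
    · obtain ⟨i1, i2, i3, i4, i5⟩ := ih h
      have hw := A_some _ _ _ h
      refine ⟨?_, ?_, ?_, ?_, ?_⟩
      · rw [lt]; split_ifs <;> omega
      · simp [sc, A, i2]
      · simp only [sc, A, i3, sc_length, List.length_cons]
        by_cases h5 : t + 1 < w.length
        · have h6 : t + 1 < w.length + 1 := by omega
          simp [h5, hw.1]
        · have h6 : t + 1 = w.length := by omega
          have h7 : (t + 1) % 2 = x := by omega
          simp [i4 h6, ← h6, h7]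
      · simp; omega
      · intro h5 h6
        rcases two b with rfl | rfl
        · have h7 : lt m w x = 2 := by
            simp only [lt] at h5; simp at h5; split_ifs at h5 <;> omega
          have h8 : (w.length + 1 - t) = (w.length - t) + 1 := by omega
          simp [sc, h7, i5 h7 h6, h8, List.replicate_succ]
        · simp [lt] at h5; omega

theorem lt_ge3 (m : ℕ) (hm : 4 ≤ m) (w : List (Fin 2)) (x : ℕ) (hx : 3 ≤ x) :
    3 ≤ lt m w x ∧ sc m w x = w := by
  induction w with
  | nil => simp [lt, sc, hx]
  | cons b w ih =>
    obtain ⟨i1, i2⟩ := ih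
    rcases two b with rfl | rfl
    · constructor
      · rw [lt]; split_ifs <;> omega
      · simp [sc, i2]; omega
    · constructor
      · simp [lt]; omega
      · simp [sc, i2]; omega

theorem lt_ge2 (m : ℕ) (hm : 3 ≤ m) (w : List (Fin 2)) : 2 ≤ lt m w 2 := by
  induction w with
  | nil => simp [lt]
  | cons b w ih => rw [lt]; split_ifs <;> omega

theorem sc_two_three (w : List (Fin 2)) :
    lt 3 w 2 = 2 ∧ sc 3 w 2 = List.replicate w.length 1 := by
  induction w with
  | nil => simp [lt, sc]
  | cons b w ih => 
    obtain ⟨i1, i2⟩ := ih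
    simp [lt, sc, i1, i2, List.replicate_succ]

theorem sc_two_eq (m : ℕ) (hm : 4 ≤ m) (w : List (Fin 2)) (h : lt m w 2 = 2) :
    sc m w 2 = List.replicate w.length 1 := by
  induction w with
  | nil => simp [sc]
  | cons b w ih =>
    have := lt_ge2 m (by omega) w
    rcases two b with rfl | rfl
    · have h7 : lt m w 2 = 2 := by
        simp only [lt] at h; simp at h; split_ifs at h <;> omega
      simp [sc, h7, ih h7, List.replicate_succ]
    · simp [lt] at h; omega

theorem main_two (m : ℕ) (hm : 4 ≤ m) (w : List (Fin 2)) :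
    A 0 (sc m w 2) = (if 1 ≤ w.length then some 0 else none) ∧
    (A 0 w = some 0 → 3 ≤ lt m w 2 ∧ A 1 (sc m w 2) = A 1 w) ∧
    (A 0 w ≠ some 0 → (w.length ≤ 1 → lt m w 2 = 2) ∧
      A 1 (sc m w 2) = (if 2 ≤ w.length then some 1 else none)) := by
  induction w with
  | nil => simp [sc, A, lt]
  | cons b w ih =>
    obtain ⟨i1, i2, i3⟩ := ih
    have h2 := lt_ge2 m (by omega) w
    have hb : ∀ q : Fin 2, (if q = 0 then (if lt m w 2 = 2 then (1 : Fin 2) else 0)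
      else (if lt m w 2 = 0 then 0 else 1)) = if lt m w 2 = 2 then 1 else q := by
      intro q
      rcases two q with rfl | rfl
      · simp
      · simp; omega
    rcases Nat.eq_zero_or_pos w.length with h0 | h0
    · rw [List.length_eq_zero_iff] at h0
      subst h0
      rcases two b with rfl | rfl
      · simp [sc, A, lt]
      · simp [sc, A, lt]; omega
    · have hA : A 0 (b :: w) = some 0 ↔ A 0 w = some 0 := by
        simp only [A]
        split_ifs with h3 h4
        · simp [h3]; intro h; simp [h] at h0
        · simp [h3]
        · rfl
      rw [if_pos (show 1 ≤ w.length from h0)] at i1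
      refine ⟨by simp [sc, A, i1], ?_, ?_⟩
      · rw [hA]
        intro h
        obtain ⟨j1, j2⟩ := i2 h
        constructor
        · rw [lt]; split_ifs <;> omega
        · rw [sc, hb, if_neg (by omega)]
          simp [A, j2, sc_length]
      · rw [Ne, hA]
        intro h
        obtain ⟨j1, j2⟩ := i3 h
        constructor
        · simp; intro h; simp [h] at h0
        · rw [sc, hb]
          simp only [A, j2, sc_length, List.length_cons]
          by_cases h5 : 2 ≤ w.length
          · have h6 : 1 ≤ w.length := h0
            simp [h5, h6]
          · have h6 : w.length = 1 := by omega
            simp [j1 (by omega), h6]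

/-- Agreement of the first odd and even positions. -/
def R0 (u v : List (Fin 2)) : Prop := A 0 u = A 0 v ∧ A 1 u = A 1 v

theorem R0.of (p x : ℕ) (hx : x + p = 1) {u v : List (Fin 2)} (h1 : A p u = A p v)
    (h2 : A x u = A x v) : R0 u v := by
  have : (x = 0 ∧ p = 1) ∨ (x = 1 ∧ p = 0) := by omega
  rcases this with ⟨rfl, rfl⟩ | ⟨rfl, rfl⟩
  · exact ⟨h2, h1⟩
  · exact ⟨h1, h2⟩

theorem R0.get (p : ℕ) (hx : p ≤ 1) {u v : List (Fin 2)} (h : R0 u v) : A p u = A p v := by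
  have : p = 0 ∨ p = 1 := by omega
  rcases this with rfl | rfl
  · exact h.1
  · exact h.2

theorem R0.cons {u v : List (Fin 2)} (b : Fin 2) (hl : u.length = v.length) (h : R0 u v) :
    R0 (b :: u) (b :: v) := by
  obtain ⟨h1, h2⟩ := h
  simp [R0, A, h1, h2, hl]

theorem R0_step (m : ℕ) (hm : 3 ≤ m) (u v : List (Fin 2)) (hl : u.length = v.length)
    (h : R0 u v) (x : ℕ) (hx : x < m) :
    min (lt m u x) 2 = min (lt m v x) 2 ∧ R0 (sc m u x) (sc m v x) := by
  have : x ≤ 1 ∨ x = 2 ∨ 3 ≤ x := by omega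
  rcases this with hx | rfl | hx
  · have hp : x + (1 - x) = 1 := by omega
    have hA := h.get (1 - x) (by omega)
    rcases hu : A (1 - x) u with _ | t
    · obtain ⟨a1, a2⟩ := main_none m hm x _ hp u hu
      obtain ⟨b1, b2⟩ := main_none m hm x _ hp v (by rw [← hA, hu])
      rw [a1, a2, b1, b2, hl]
      exact ⟨rfl, rfl, rfl⟩
    · obtain ⟨a1, a2, a3, -⟩ := main_some m hm x _ hp u t hu
      obtain ⟨b1, b2, b3, -⟩ := main_some m hm x _ hp v t (by rw [← hA, hu])
      refine ⟨by omega, R0.of _ _ hp (by rw [a2, b2]) (by rw [a3, b3, hl])⟩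
  · refine ⟨by have := lt_ge2 m hm u; have := lt_ge2 m hm v; omega, ?_⟩
    rcases Nat.eq_or_lt_of_le hm with rfl | hm
    · rw [(sc_two_three u).2, (sc_two_three v).2, hl]; exact ⟨rfl, rfl⟩
    · obtain ⟨a1, a2, a3⟩ := main_two m hm u
      obtain ⟨b1, b2, b3⟩ := main_two m hm v
      refine ⟨by rw [a1, b1, hl], ?_⟩
      by_cases h0 : A 0 u = some 0
      · rw [(a2 h0).2, (b2 (h.1 ▸ h0)).2, h.2]
      · rw [(a3 h0).2, (b3 (h.1 ▸ h0)).2, hl]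
  · have a := lt_ge3 m (by omega) u x hx
    have b := lt_ge3 m (by omega) v x hx
    refine ⟨by omega, ?_⟩
    rw [a.2, b.2]; exact h

/-- The complete invariant: the states down to the `k`-th `q1` from the left, then the first
even and odd positions of `q1` in the rest. -/
def inv : ℕ → List (Fin 2) → List (Fin 2) × Option ℕ × Option ℕ
  | 0, w => ([], A 0 w, A 1 w)
  | _ + 1, [] => ([], none, none)
  | k + 1, b :: w =>
    if b = 0 then (0 :: (inv (k + 1) w).1, (inv (k + 1) w).2) else (1 :: (inv k w).1, (inv k w).2)

theorem inv_zero (u v : List (Fin 2)) : inv 0 u = inv 0 v ↔ R0 u v := by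
  simp [inv, R0]

theorem inv_cons0 (k : ℕ) (u v : List (Fin 2)) :
    inv (k + 1) (0 :: u) = inv (k + 1) (0 :: v) ↔ inv (k + 1) u = inv (k + 1) v := by
  simp [inv, Prod.ext_iff]

theorem inv_cons1 (k : ℕ) (u v : List (Fin 2)) :
    inv (k + 1) (1 :: u) = inv (k + 1) (1 :: v) ↔ inv k u = inv k v := by
  simp [inv, Prod.ext_iff]

theorem inv_ne (k : ℕ) (u v : List (Fin 2)) :
    inv (k + 1) (0 :: u) ≠ inv (k + 1) (1 :: v) := by
  simp [inv, Prod.ext_iff]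

theorem inv_mono (k : ℕ) (u v : List (Fin 2)) (hl : u.length = v.length)
    (h : inv (k + 1) u = inv (k + 1) v) : inv k u = inv k v := by
  induction k generalizing u v with
  | zero =>
    induction u generalizing v with
    | nil => cases v <;> simp_all
    | cons a u ih =>
      rcases v with _ | ⟨b, v⟩
      · simp at hl
      · simp at hl
        rcases two a with rfl | rfl <;> rcases two b with rfl | rfl
        · rw [inv_cons0] at h
          rw [inv_zero]; exact R0.cons _ hl ((inv_zero _ _).1 (ih v hl h))
        · exact absurd h (inv_ne _ _ _)
        · exact absurd h.symm (inv_ne _ _ _)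
        · rw [inv_cons1] at h
          rw [inv_zero]; exact R0.cons _ hl ((inv_zero _ _).1 h)
  | succ k ihk =>
    induction u generalizing v with
    | nil => cases v <;> simp_all
    | cons a u ih =>
      rcases v with _ | ⟨b, v⟩
      · simp at hl
      · simp at hl
        rcases two a with rfl | rfl <;> rcases two b with rfl | rfl
        · rw [inv_cons0] at h ⊢
          exact ih v hl h
        · exact absurd h (inv_ne _ _ _)
        · exact absurd h.symm (inv_ne _ _ _)
        · rw [inv_cons1] at h ⊢
          exact ihk _ _ hl h

theorem main_zero (m : ℕ) (hm : 3 ≤ m) (w : List (Fin 2)) (x : ℕ) (h : lt m w x = 0) :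
    sc m w x = List.replicate w.length 0 := by
  have : x ≤ 1 ∨ 2 ≤ x := by omega
  rcases this with hx | hx
  · rcases hu : A (1 - x) w with _ | t
    · exact (main_none m hm x _ (by omega) w hu).1
    · have := (main_some m hm x _ (by omega) w t hu).1
      omega
  · exfalso
    have : ∀ w, 2 ≤ lt m w x := by
      intro w
      induction w with
      | nil => exact hx
      | cons b w ih => rw [lt]; split_ifs <;> omega
    have := this w
    omega

theorem inv_step (m : ℕ) (hm : 3 ≤ m) (k : ℕ) (hk : k + 3 ≤ m) (u v : List (Fin 2))
    (hl : u.length = v.length) (h : inv k u = inv k v) (x : ℕ) (hx : x < m) :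
    min (lt m u x) (k + 2) = min (lt m v x) (k + 2) ∧ inv k (sc m u x) = inv k (sc m v x) := by
  induction k generalizing u v with
  | zero => 
    rw [inv_zero] at h ⊢
    exact R0_step m hm u v hl h x hx
  | succ k ihk =>
    induction u generalizing v with
    | nil => cases v <;> simp_all
    | cons a u ih =>
      rcases v with _ | ⟨b, v⟩
      · simp at hl
      · simp at hl
        rcases two a with rfl | rfl <;> rcases two b with rfl | rfl
        · rw [inv_cons0] at h
          obtain ⟨j1, j2⟩ := ih v hl h
          constructor
          · simp only [lt, if_true]; split_ifs <;> omega
          · simp only [sc, if_true]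
            have : lt m u x = 2 ↔ lt m v x = 2 := by omega
            by_cases h2 : lt m u x = 2
            · rw [if_pos h2, if_pos (this.1 h2), inv_cons1]
              exact inv_mono _ _ _ (by simp [sc_length, hl]) j2
            · rw [if_neg h2, if_neg (fun h => h2 (this.2 h)), inv_cons0]
              exact j2
        · exact absurd h (inv_ne _ _ _)
        · exact absurd h.symm (inv_ne _ _ _)
        · rw [inv_cons1] at h
          obtain ⟨j1, j2⟩ := ihk (by omega) u v hl h
          constructor
          · simp [lt]; omega
          · simp only [sc, one_ne_zero, if_false]
            have : lt m u x = 0 ↔ lt m v x = 0 := by omega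
            by_cases h2 : lt m u x = 0
            · rw [if_pos h2, if_pos (this.1 h2), main_zero m hm u x h2,
                main_zero m hm v x (this.1 h2), hl]
            · rw [if_neg h2, if_neg (fun h => h2 (this.2 h)), inv_cons1]
              exact j2

/-- Output of `w` on the stream `s`, at index `i`. -/
def ev (m : ℕ) : List (Fin 2) → (ℕ → ℕ) → ℕ → ℕ
  | w, s, 0 => lt m w (s 0)
  | w, s, i + 1 => ev m (sc m w (s 0)) (fun j => s (j + 1)) i

/-- Agreement of the outputs of two words up to truncation at `c`. -/
def H (m c : ℕ) (u v : List (Fin 2)) : Prop :=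
  ∀ s : ℕ → ℕ, (∀ i, s i < m) → ∀ i, min (ev m u s i) c = min (ev m v s i) c

theorem inv_sound (m : ℕ) (hm : 3 ≤ m) (k : ℕ) (hk : k + 3 ≤ m) (u v : List (Fin 2))
    (hl : u.length = v.length) (h : inv k u = inv k v) : H m (k + 2) u v := by
  intro s hs i
  induction i generalizing u v s with
  | zero => exact (inv_step m hm k hk u v hl h _ (hs 0)).1
  | succ i ih =>
    exact ih _ _ (by simp [sc_length, hl]) (inv_step m hm k hk u v hl h _ (hs 0)).2 _
      (fun j => hs (j + 1))

theorem H.symm {m c : ℕ} {u v : List (Fin 2)} (h : H m c u v) : H m c v u :=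
  fun s hs i => (h s hs i).symm

theorem H.lt {m c : ℕ} {u v : List (Fin 2)} (h : H m c u v) (x : ℕ) (hx : x < m) :
    min (lt m u x) c = min (BM.lt m v x) c := h (fun _ => x) (fun _ => hx) 0

theorem H.sc {m c : ℕ} {u v : List (Fin 2)} (h : H m c u v) (x : ℕ) (hx : x < m) :
    H m c (sc m u x) (BM.sc m v x) := by
  intro s hs i
  exact h (fun j => Nat.casesOn j x s) (by rintro (_ | j); exacts [hx, hs j]) (i + 1)

theorem H.mono {m c d : ℕ} {u v : List (Fin 2)} (h : H m c u v) (hd : d ≤ c) : H m d u v := by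
  intro s hs i
  have := h s hs i
  omega

theorem H2_aux (m : ℕ) (hm : 3 ≤ m) (d : ℕ) : ∀ (t p : ℕ) (u v : List (Fin 2)), p ≤ 1 →
    u.length = v.length → H m 2 u v → u.length = t + 1 + d → A p u = some t → A p v = some t := by
  induction d with
  | zero =>
    intro t p u v hp hl h hd hA
    have hx : (1 - p) + p = 1 := by omega
    obtain ⟨a1, a2, a3, -⟩ := main_some m hm _ _ hx u t hA
    have h1 := h.lt (1 - p) (by omega)
    rcases hv : A p v with _ | t'
    · have := (main_none m hm _ _ hx v hv).2
      omega
    · obtain ⟨b1, b2, b3, -⟩ := main_some m hm _ _ hx v t' hv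
      have hs := A_some _ _ _ hv
      by_cases h2 : t' + 1 < v.length
      · rw [if_pos h2] at b3
        rw [if_neg (by omega)] at a3
        have h3 := (h.sc (1 - p) (by omega)).lt p (by omega)
        have a4 := (main_none m hm p (1 - p) (by omega) _ a3).2
        have b4 := (main_some m hm p (1 - p) (by omega) _ _ b3).1
        omega
      · congr 1; omega
  | succ d ih =>
    intro t p u v hp hl h hd hA
    have hx : (1 - p) + p = 1 := by omega
    obtain ⟨a1, a2, a3, -⟩ := main_some m hm _ _ hx u t hA
    have h1 := h.lt (1 - p) (by omega)
    rcases hv : A p v with _ | t'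
    · have := (main_none m hm _ _ hx v hv).2
      omega
    · obtain ⟨b1, b2, b3, -⟩ := main_some m hm _ _ hx v t' hv
      rw [if_pos (by omega)] at a3
      have := ih (t + 1) (1 - p) _ _ (by omega) (by simp [sc_length, hl]) (h.sc (1 - p) (by omega))
        (by rw [sc_length]; omega) a3
      rw [this] at b3
      split_ifs at b3
      simp at b3
      rw [b3]

theorem H2_R0 (m : ℕ) (hm : 3 ≤ m) (u v : List (Fin 2)) (hl : u.length = v.length)
    (h : H m 2 u v) : R0 u v := by
  have key : ∀ p ≤ 1, A p u = A p v := by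
    intro p hp
    rcases hu : A p u with _ | t
    · rcases hv : A p v with _ | t
      · rfl
      · have := A_some _ _ _ hv
        have := H2_aux m hm (v.length - (t + 1)) t p v u hp hl.symm h.symm (by omega) hv
        simp_all
    · have := A_some _ _ _ hu
      exact (H2_aux m hm (u.length - (t + 1)) t p u v hp hl h (by omega) hu).symm
  exact ⟨key 0 (by omega), key 1 (by omega)⟩

theorem H3_aux (m : ℕ) (hm : 4 ≤ m) (d : ℕ) : ∀ (t p : ℕ) (u v : List (Fin 2)), p ≤ 1 →
    H m 3 (0 :: u) (1 :: v) → u.length = v.length → u.length = t + 1 + d →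
    A p u = some t → A p v = some t → False := by
  induction d with
  | zero =>
    intro t p u v hp h hl hd hu hv
    have hx : (1 - p) + p = 1 := by omega
    obtain ⟨a1, a2, a3, a4, -⟩ := main_some m (by omega) _ _ hx u t hu
    obtain ⟨b1, b2, b3, b4, -⟩ := main_some m (by omega) _ _ hx v t hv
    have h1 := h.lt (1 - p) (by omega)
    simp [lt, a4 (by omega), b4 (by omega)] at h1
    omega
  | succ d ih =>
    intro t p u v hp h hl hd hu hv
    have hx : (1 - p) + p = 1 := by omega
    obtain ⟨a1, a2, a3, a4, -⟩ := main_some m (by omega) _ _ hx u t hu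
    obtain ⟨b1, b2, b3, b4, -⟩ := main_some m (by omega) _ _ hx v t hv
    have h1 := h.lt (1 - p) (by omega)
    have h2 := h.sc (1 - p) (by omega)
    by_cases h3 : lt m u (1 - p) = 2
    · simp [lt, h3] at h1
      omega
    · rw [sc, sc] at h2
      simp only [if_true, one_ne_zero, if_false, if_neg h3] at h2
      rw [if_neg (by omega)] at h2
      rw [if_pos (by omega)] at a3 b3
      exact ih (t + 1) (1 - p) _ _ (by omega) h2 (by simp [sc_length, hl])
        (by rw [sc_length]; omega) a3 b3

theorem H3_mixed (m : ℕ) (hm : 4 ≤ m) (u v : List (Fin 2)) (hl : u.length = v.length)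
    (h : H m 3 (0 :: u) (1 :: v)) : False := by
  have hR := H2_R0 m (by omega) (0 :: u) (1 :: v) (by simp [hl]) (h.mono (by omega))
  have hp : u.length % 2 ≤ 1 := by omega
  have hA := hR.get _ hp
  simp only [A, hl] at hA
  simp at hA
  rcases hu : A (v.length % 2) u with _ | t
  · rcases hv : A (v.length % 2) v with _ | t <;> simp [hu, hv] at hA
  · have hs := A_some _ _ _ hu
    rcases hv : A (v.length % 2) v with _ | t'
    · simp [hu, hv] at hA
      omega
    · simp [hu, hv] at hA
      subst hA
      exact H3_aux m hm (u.length - (t + 1)) t _ u v (by omega) h hl (by omega) hu hv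

theorem sc_eq_of_two (m : ℕ) (hm : 4 ≤ m) (u v : List (Fin 2)) (hl : u.length = v.length)
    (hR : R0 u v) (x : ℕ) (hu : lt m u x = 2) (hv : lt m v x = 2) : sc m u x = sc m v x := by
  have : x ≤ 1 ∨ x = 2 ∨ 3 ≤ x := by omega
  rcases this with hx | rfl | hx
  · have hp : x + (1 - x) = 1 := by omega
    have hA := hR.get (1 - x) (by omega)
    rcases hu' : A (1 - x) u with _ | t
    · have := (main_none m (by omega) x _ hp u hu').2
      omega
    · rw [(main_some m (by omega) x _ hp u t hu').2.2.2.2 hu hm,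
        (main_some m (by omega) x _ hp v t (hA ▸ hu')).2.2.2.2 hv hm, hl]
  · rw [sc_two_eq m hm u hu, sc_two_eq m hm v hv, hl]
  · have := (lt_ge3 m hm u x hx).1
    omega

theorem R0_of_cons0 {u v : List (Fin 2)} (hl : u.length = v.length) (h : R0 (0 :: u) (0 :: v)) :
    R0 u v := by
  have e : ∀ p (w : List (Fin 2)), A p (0 :: w) = A p w := by
    intro p w
    simp only [A]
    split_ifs with h1 h2 <;> simp_all
  simpa [R0, e] using h

theorem H_cons0 (m : ℕ) (hm : 4 ≤ m) (c : ℕ) (hc : 3 ≤ c) (u v : List (Fin 2))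
    (hl : u.length = v.length) (h : H m c (0 :: u) (0 :: v)) : H m c u v := by
  intro s hs i
  induction i generalizing u v s with
  | zero =>
    have h1 := h.lt (s 0) (hs 0)
    simp only [lt, if_true] at h1
    simp only [ev]
    split_ifs at h1 <;> omega
  | succ i ih =>
    have h1 := h.lt (s 0) (hs 0)
    have h2 := h.sc (s 0) (hs 0)
    simp only [lt, if_true] at h1
    have h3 : lt m u (s 0) = 2 ↔ lt m v (s 0) = 2 := by split_ifs at h1 <;> omega
    rw [ev, ev]
    by_cases h4 : lt m u (s 0) = 2
    · have hR := H2_R0 m (by omega) _ _ (by simp [hl]) (h.mono (show 2 ≤ c by omega))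
      rw [sc_eq_of_two m hm u v hl (R0_of_cons0 hl hR) _ h4 (h3.1 h4)]
    · simp only [sc, if_true, if_neg h4, if_neg (fun h => h4 (h3.2 h))] at h2
      exact ih _ _ (by simp [sc_length, hl]) h2 _ (fun j => hs (j + 1))

theorem H_cons1 (m : ℕ) (hm : 4 ≤ m) (c : ℕ) (hc : 2 ≤ c) (hcm : c + 2 ≤ m) (u v : List (Fin 2))
    (hl : u.length = v.length) (h : H m (c + 1) (1 :: u) (1 :: v)) : H m c u v := by
  intro s hs i
  induction i generalizing u v s with
  | zero =>
    have h1 := h.lt (s 0) (hs 0)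
    simp only [lt, one_ne_zero, if_false] at h1
    simp only [ev]
    omega
  | succ i ih =>
    have h1 := h.lt (s 0) (hs 0)
    have h2 := h.sc (s 0) (hs 0)
    simp only [lt, one_ne_zero, if_false] at h1
    have h3 : lt m u (s 0) = 0 ↔ lt m v (s 0) = 0 := by omega
    rw [ev, ev]
    by_cases h4 : lt m u (s 0) = 0
    · rw [main_zero m (by omega) u _ h4, main_zero m (by omega) v _ (h3.1 h4), hl]
    · simp only [sc, one_ne_zero, if_false, if_neg h4, if_neg (fun h => h4 (h3.2 h))] at h2
      exact ih _ _ (by simp [sc_length, hl]) h2 _ (fun j => hs (j + 1))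

theorem inv_complete (m : ℕ) (hm : 3 ≤ m) (k : ℕ) (hk : k + 3 ≤ m) (u v : List (Fin 2))
    (hl : u.length = v.length) (h : H m (k + 2) u v) : inv k u = inv k v := by
  induction k generalizing u v with
  | zero => 
    rw [inv_zero]
    exact H2_R0 m hm u v hl h
  | succ k ihk =>
    induction u generalizing v with
    | nil => cases v <;> simp_all
    | cons a u ih =>
      rcases v with _ | ⟨b, v⟩
      · simp at hl
      · simp at hl
        rcases two a with rfl | rfl <;> rcases two b with rfl | rfl
        · rw [inv_cons0]
          exact ih v hl (H_cons0 m (by omega) _ (by omega) u v hl h)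
        · exact (H3_mixed m (by omega) u v hl (h.mono (by omega))).elim
        · exact (H3_mixed m (by omega) v u hl.symm (h.symm.mono (by omega))).elim
        · rw [inv_cons1]
          exact ihk (by omega) u v hl (H_cons1 m (by omega) (k + 2) (by omega) (by omega) u v hl h)

/-! Link with the transformations. -/

theorem wordTrans_cons (m : ℕ) (q : Fin 2) (w : List (Fin 2)) (s : ℕ → Fin m) :
    wordTrans (bmTr m) (bmOut m) (q :: w) s =
      autTrans (bmTr m) (bmOut m) q (wordTrans (bmTr m) (bmOut m) w s) := rfl

theorem wordTrans_zero (m : ℕ) (hm : 3 ≤ m) (w : List (Fin 2)) (s : ℕ → Fin m) :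
    ((wordTrans (bmTr m) (bmOut m) w s 0).val) = lt m w (s 0) := by
  induction w with
  | nil => rfl
  | cons q w ih =>
    rw [wordTrans_cons, lt, ← ih]
    simp only [autTrans, stateSeq, bmOut]
    have : 1 % m = 1 := Nat.mod_eq_of_lt (by omega)
    by_cases h1 : q = 0
    · by_cases h2 : (wordTrans (bmTr m) (bmOut m) w s 0).val = 0
      · simp [h1, h2, this]
      · by_cases h3 : (wordTrans (bmTr m) (bmOut m) w s 0).val = 1
        · simp [h1, h3]
        · simp [h1, h2, h3]
    · simp [h1]

theorem stateSeq_succ {X Q : Type*} (tr : X → Q → Q) (q : Q) (u : ℕ → X) (n : ℕ) :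
    stateSeq tr q u (n + 1) = stateSeq tr (tr (u 0) q) (fun j => u (j + 1)) n := by
  induction n with
  | zero => rfl
  | succ n ih => rw [stateSeq, ih]; rfl

theorem wordTrans_succ (m : ℕ) (hm : 3 ≤ m) (w : List (Fin 2)) (s : ℕ → Fin m) :
    (fun j => wordTrans (bmTr m) (bmOut m) w s (j + 1)) =
      wordTrans (bmTr m) (bmOut m) (sc m w (s 0)) (fun j => s (j + 1)) := by
  induction w with
  | nil => rfl
  | cons q w ih =>
    rw [sc, wordTrans_cons, wordTrans_cons, ← ih]
    funext j
    simp only [autTrans, stateSeq_succ]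
    rw [← wordTrans_zero m hm w s]
    rfl

theorem wordTrans_ev (m : ℕ) (hm : 3 ≤ m) (w : List (Fin 2)) (s : ℕ → Fin m) (i : ℕ) :
    ((wordTrans (bmTr m) (bmOut m) w s i).val) = ev m w (fun j => s j) i := by
  induction i generalizing w s with
  | zero => exact wordTrans_zero m hm w s
  | succ i ih =>
    rw [ev, ← ih (sc m w (s 0)) (fun j => s (j + 1)), ← wordTrans_succ m hm]

theorem wordTrans_eq_iff (k : ℕ) (u v : List (Fin 2)) (hl : u.length = v.length) :
    wordTrans (bmTr (k + 3)) (bmOut (k + 3)) u = wordTrans (bmTr (k + 3)) (bmOut (k + 3)) v ↔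
      inv k u = inv k v := by
  constructor
  · intro h
    refine inv_complete (k + 3) (by omega) k le_rfl u v hl ?_
    intro s hs i
    have hu := wordTrans_ev (k + 3) (by omega) u (fun j => ⟨s j, hs j⟩) i
    have hv := wordTrans_ev (k + 3) (by omega) v (fun j => ⟨s j, hs j⟩) i
    rw [← hu, ← hv, h]
  · intro h
    funext s i
    have := inv_sound (k + 3) (by omega) k le_rfl u v hl h (fun j => s j) (fun j => (s j).2) i
    rw [← wordTrans_ev (k + 3) (by omega), ← wordTrans_ev (k + 3) (by omega)] at this
    apply Fin.ext
    omega

/-! Counting. -/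

/-- Words of length `n`. -/
def W (n : ℕ) : Set (List (Fin 2)) := {w | w.length = n}

theorem W_finite (n : ℕ) : (W n).Finite := List.finite_length_eq (Fin 2) n

theorem W_succ (n : ℕ) : W (n + 1) = (List.cons 0 '' W n) ∪ (List.cons 1 '' W n) := by
  ext w
  rcases w with _ | ⟨b, w⟩
  · simp [W]
  · rcases two b with rfl | rfl <;> simp [W]

/-- The number of values of the invariant on words of length `n`. -/
noncomputable def G (k n : ℕ) : ℕ := (inv k '' W n).ncard

theorem growth_eq (k n : ℕ) : growth (bmTr (k + 3)) (bmOut (k + 3)) n = G k n := by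
  have e : growth (bmTr (k + 3)) (bmOut (k + 3)) n =
    (wordTrans (bmTr (k + 3)) (bmOut (k + 3)) '' W n).ncard := rfl
  rw [e, G]
  symm
  choose! f hf using fun y (hy : y ∈ inv k '' W n) => hy
  refine Set.ncard_congr (fun a _ => wordTrans (bmTr (k + 3)) (bmOut (k + 3)) (f a)) ?_ ?_ ?_
  · intro a ha
    exact ⟨_, (hf a ha).1, rfl⟩
  · intro a b ha hb h
    have h1 := (wordTrans_eq_iff k _ _ ((hf a ha).1.trans (hf b hb).1.symm)).1 h
    rw [← (hf a ha).2, ← (hf b hb).2, h1]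
  · rintro _ ⟨w, hw, rfl⟩
    have hm : inv k w ∈ inv k '' W n := ⟨w, hw, rfl⟩
    exact ⟨inv k w, hm, (wordTrans_eq_iff k _ _ ((hf _ hm).1.trans hw.symm)).2 (hf _ hm).2⟩

theorem G_succ (k n : ℕ) : G (k + 1) (n + 1) = G (k + 1) n + G k n := by
  have h0 : inv (k + 1) ∘ List.cons 0 = (fun y => (0 :: y.1, y.2)) ∘ inv (k + 1) := by
    funext w; simp [inv]
  have h1 : inv (k + 1) ∘ List.cons 1 = (fun y => (1 :: y.1, y.2)) ∘ inv k := by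
    funext w; simp [inv]
  have i0 : Function.Injective (fun y : List (Fin 2) × Option ℕ × Option ℕ =>
      ((0 : Fin 2) :: y.1, y.2)) := by
    intro a b h; simpa [Prod.ext_iff] using h
  have i1 : Function.Injective (fun y : List (Fin 2) × Option ℕ × Option ℕ =>
      ((1 : Fin 2) :: y.1, y.2)) := by
    intro a b h; simpa [Prod.ext_iff] using h
  have hd : Disjoint (inv (k + 1) ∘ List.cons 0 '' W n) (inv (k + 1) ∘ List.cons 1 '' W n) := by
    rw [Set.disjoint_left]
    rintro _ ⟨u, _, rfl⟩ ⟨v, _, h⟩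
    exact inv_ne k u v h.symm
  rw [G, W_succ, Set.image_union, ← Set.image_comp, ← Set.image_comp,
    Set.ncard_union_eq hd ((W_finite n).image _) ((W_finite n).image _),
    h0, h1, Set.image_comp, Set.image_comp _ (inv k), Set.ncard_image_of_injective _ i0,
    Set.ncard_image_of_injective _ i1]
  rfl

/-- Possible values of `A p` on words of length `n`. -/
def D (p n : ℕ) : Finset (Option ℕ) :=
  insert none (((Finset.range n).filter (fun i => i % 2 = p)).image some)

theorem mem_D (p n : ℕ) (a : Option ℕ) :
    a ∈ D p n ↔ ∀ t, a = some t → t < n ∧ t % 2 = p := by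
  rcases a with _ | t <;> simp [D]

theorem D_card (p n : ℕ) : (D p n).card = ((Finset.range n).filter (fun i => i % 2 = p)).card + 1 := by
  rw [D, Finset.card_insert_of_notMem (by simp),
    Finset.card_image_of_injective _ (Option.some_injective _)]

theorem D_succ (p n : ℕ) : (D p (n + 1)).card = (D p n).card + if n % 2 = p then 1 else 0 := by
  rw [D_card, D_card, Finset.range_add_one, Finset.filter_insert]
  split_ifs with h
  · rw [Finset.card_insert_of_notMem (by simp)]
  · rfl

theorem A_surj (n : ℕ) : ∀ a ∈ D 0 n, ∀ b ∈ D 1 n, ∃ w ∈ W n, A 0 w = a ∧ A 1 w = b := by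
  induction n with
  | zero =>
    intro a ha b hb
    simp [D] at ha hb
    subst ha hb
    exact ⟨[], rfl, rfl, rfl⟩
  | succ n ih =>
    intro a ha b hb
    rw [mem_D] at ha hb
    by_cases h0 : a = some n
    · obtain ⟨w, hw, h1, h2⟩ := ih none (by simp [mem_D]) b (by
        rw [mem_D]; intro t ht; have := hb t ht; have := ha n h0
        have : t ≠ n := by rintro rfl; omega
        omega)
      have hp := (ha n h0).2
      have hw' : w.length = n := hw
      exact ⟨1 :: w, by simp [W, hw'], by simp [A, h1, hw', hp, h0], by
        simp [A, h2, hw', hp]; intro h; exact h.symm⟩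
    · by_cases h1 : b = some n
      · obtain ⟨w, hw, h3, h2⟩ := ih a (by
          rw [mem_D]; intro t ht; have := ha t ht
          have : t ≠ n := by rintro rfl; exact h0 ht
          omega) none (by simp [mem_D])
        have hp := (hb n h1).2
        have hw' : w.length = n := hw
        exact ⟨1 :: w, by simp [W, hw'], by
          simp [A, h3, hw', hp]; intro h; exact h.symm, by simp [A, h2, hw', hp, h1]⟩
      · obtain ⟨w, hw, h3, h2⟩ := ih a (by
          rw [mem_D]; intro t ht; have := ha t ht
          have : t ≠ n := by rintro rfl; exact h0 ht
          omega) b (by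
          rw [mem_D]; intro t ht; have := hb t ht
          have : t ≠ n := by rintro rfl; exact h1 ht
          omega)
        have hw' : w.length = n := hw
        exact ⟨0 :: w, by simp [W, hw'], by simp [A, h3]; intro h; exact h.symm,
          by simp [A, h2]; intro h; exact h.symm⟩

theorem G_zero (n : ℕ) : G 0 n = (D 0 n).card * (D 1 n).card := by
  have : inv 0 '' W n = (fun y => (([] : List (Fin 2)), y)) '' ((D 0 n ×ˢ D 1 n : Finset _) : Set _) := by
    ext ⟨l, a, b⟩
    constructor
    · rintro ⟨w, hw, h⟩
      simp only [inv, Prod.mk.injEq] at h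
      obtain ⟨rfl, rfl, rfl⟩ := h
      have hw' : w.length = n := hw
      refine ⟨_, ?_, rfl⟩
      simp only [Finset.coe_product, Set.mem_prod, Finset.mem_coe, mem_D]
      subst hw'
      exact ⟨fun t ht => A_some _ _ _ ht, fun t ht => A_some _ _ _ ht⟩
    · rintro ⟨⟨a', b'⟩, h, e⟩
      simp only [Prod.mk.injEq] at e
      obtain ⟨rfl, rfl, rfl⟩ := e
      simp only [Finset.coe_product, Set.mem_prod, Finset.mem_coe] at h
      obtain ⟨w, hw, h1, h2⟩ := A_surj n _ h.1 _ h.2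
      exact ⟨w, hw, by simp [inv, h1, h2]⟩
  rw [G, this, Set.ncard_image_of_injective _ (Prod.mk_right_injective _), Set.ncard_coe_finset,
    Finset.card_product]

theorem D_even (r : ℕ) : (D 0 (r + r)).card = r + 1 ∧ (D 1 (r + r)).card = r + 1 := by
  induction r with
  | zero => simp [D]
  | succ r ih =>
    have e : r + 1 + (r + 1) = r + r + 1 + 1 := by omega
    rw [e, D_succ, D_succ, D_succ, D_succ, ih.1, ih.2]
    constructor <;> split_ifs <;> omega

theorem fdiff_succ (k i N : ℕ) (hN : i ≤ N) :
    fdiff (fun n => (G (k + 1) n : ℤ)) (i + 1) (N + 1) = fdiff (fun n => (G k n : ℤ)) i N := by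
  induction i generalizing N with
  | zero => simp [fdiff, G_succ]
  | succ i ih =>
    obtain ⟨N, rfl⟩ : ∃ M, N = M + 1 := ⟨N - 1, by omega⟩
    have a := ih (N + 1) (by omega)
    have b := ih N (by omega)
    change fdiff _ (i + 1) (N + 1 + 1) - fdiff _ (i + 1) (N + 1) =
      fdiff _ i (N + 1) - fdiff _ i N
    rw [a, b]

theorem fdiff_all (k N : ℕ) :
    fdiff (fun n => (G k n : ℤ)) (k + 1) (N + 1 + k) = fdiff (fun n => (G 0 n : ℤ)) 1 (N + 1) := by
  induction k with
  | zero => rfl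
  | succ k ih => rw [← ih, ← fdiff_succ k (k + 1) _ (by omega)]; rfl

theorem final (n : ℕ) (hn : Even n) :
    fdiff (fun n => (G 0 n : ℤ)) 1 (n + 2 + 1) = fdiff (fun n => (G 0 n : ℤ)) 1 (n + 1 + 1) := by
  obtain ⟨r, rfl⟩ := hn
  obtain ⟨h0, h1⟩ := D_even r
  simp only [fdiff, Nat.add_sub_cancel, G_zero, D_succ, h0, h1]
  have e0 : (r + r) % 2 = 0 := by omega
  have e1 : (r + r + 1) % 2 = 1 := by omega
  have e2 : (r + r + 2) % 2 = 0 := by omega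
  have e3 : (r + r + 1 + 1) % 2 = 0 := by omega
  simp [e0, e1, e2]
  ring

end BM

/-- For every `m ≥ 3`, the `(m−2)`-th finite difference of the growth function `γ` of the
automaton `B_m` consists of doubled values: for every even `n ≥ 0`,
`γ^(m−2)(n+m) = γ^(m−2)(n+m−1)`. -/
theorem fdiff_doubled_bm (m : ℕ) (hm : 3 ≤ m) (n : ℕ) (hn : Even n) :
    fdiff (fun k => (growth (bmTr m) (bmOut m) k : ℤ)) (m - 2) (n + m) =
      fdiff (fun k => (growth (bmTr m) (bmOut m) k : ℤ)) (m - 2) (n + m - 1) := by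
  obtain ⟨k, rfl⟩ : ∃ k, m = k + 3 := ⟨m - 3, by omega⟩
  have h1 : k + 3 - 2 = k + 1 := by omega
  have h2 : n + (k + 3) = n + 2 + 1 + k := by omega
  have h3 : n + 2 + 1 + k - 1 = n + 1 + 1 + k := by omega
  simp only [BM.growth_eq]
  rw [h1, h2, h3, BM.fdiff_all, BM.fdiff_all k (n + 1), BM.final n hn]
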